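/- The canonical game satisfies the play-existence condition of games: For any maximal consistent set X_0, each initial state α ∈ I of the canonical game G(X_0), and each complete action profile δ ∈ Δ^A, there is an outcome ω ∈ Ω such that (α, δ, ω) ∈ P. -/

import Mathlib

inductive Formula (A Prp : Type) : Type
  | var : Prp → Formula A Prp
  | bot : Formula A Prp
  | neg : Formula A Prp → Formula A Prp
  | imp : Formula A Prp → Formula A Prp → Formula A Prp
  | know : Set A → Formula A Prp → Formula A Prp
  | blame : Set A → Formula A Prp → Formula A Prp

namespace Formula
variable {A Prp : Type}
def top : Formula A Prp := neg bot
def or (φ ψ : Formula A Prp) : Formula A Prp := imp (neg φ) ψ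
def and (φ ψ : Formula A Prp) : Formula A Prp := neg (imp φ (neg ψ))
def kbar (C : Set A) (φ : Formula A Prp) : Formula A Prp := neg (know C (neg φ))
end Formula

def evalF {A Prp : Type} (v : Formula A Prp → Prop) : Formula A Prp → Prop
  | .var p => v (.var p)
  | .bot => False
  | .neg φ => ¬ evalF v φ
  | .imp φ ψ => evalF v φ → evalF v ψ
  | .know C φ => v (.know C φ)
  | .blame C φ => v (.blame C φ)

def Tautology {A Prp : Type} (φ : Formula A Prp) : Prop := ∀ v, evalF v φ

inductive Provable {A Prp : Type} : Formula A Prp → Prop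
  | taut {φ} : Tautology φ → Provable φ
  | truthK {C φ} : Provable (.imp (.know C φ) φ)
  | truthB {C φ} : Provable (.imp (.blame C φ) φ)
  | distr {C φ ψ} : Provable (.imp (.know C (.imp φ ψ)) (.imp (.know C φ) (.know C ψ)))
  | negIntro {C φ} : Provable (.imp (.neg (.know C φ)) (.know C (.neg (.know C φ))))
  | monoK {C D φ} (h : C ⊆ D) : Provable (.imp (.know C φ) (.know D φ))
  | monoB {C D φ} (h : C ⊆ D) : Provable (.imp (.blame C φ) (.blame D φ))
  | noneBlame {φ} : Provable (.neg (.blame (∅ : Set A) φ))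
  | blameTop {C} : Provable (.neg (.blame C Formula.top))
  | jointResp {C D φ ψ} (h : Disjoint C D) :
      Provable (.imp (.and (.kbar C (.blame C φ)) (.kbar D (.blame D ψ)))
        (.imp (.or φ ψ) (.blame (C ∪ D) (.or φ ψ))))
  | knownCause {C φ ψ} :
      Provable (.imp (.know C (.imp φ ψ)) (.imp (.blame C ψ) (.imp φ (.blame C φ))))
  | fairness {C φ} : Provable (.imp (.blame C φ) (.know C (.imp φ (.blame C φ))))
  | mp {φ ψ} : Provable (.imp φ ψ) → Provable φ → Provable ψ
  | nec {C φ} : Provable φ → Provable (.know C φ)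

inductive ProvableFrom {A Prp : Type} (X : Set (Formula A Prp)) : Formula A Prp → Prop
  | thm {φ} : Provable φ → ProvableFrom X φ
  | hyp {φ} : φ ∈ X → ProvableFrom X φ
  | mp {φ ψ} : ProvableFrom X (.imp φ ψ) → ProvableFrom X φ → ProvableFrom X ψ

def Consistent {A Prp : Type} (X : Set (Formula A Prp)) : Prop :=
  ¬ ProvableFrom X Formula.bot

/-- Maximal consistent set of formulae. -/
def MaxCons {A Prp : Type} (X : Set (Formula A Prp)) : Prop :=
  Consistent X ∧ ∀ Y, Consistent Y → X ⊆ Y → Y = X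

/-- A valid chain `C₁, X₁, …, Cₙ, Xₙ` extending a set `X`: each `Xᵢ` is maximal
consistent and `{φ | K_{Cᵢ} φ ∈ X_{i-1}} ⊆ Xᵢ`. -/
def ValidChain {A Prp : Type} :
    Set (Formula A Prp) → List (Set A × Set (Formula A Prp)) → Prop
  | _, [] => True
  | X, (C, Y) :: rest =>
      MaxCons Y ∧ (∀ φ, Formula.know C φ ∈ X → φ ∈ Y) ∧ ValidChain Y rest

/-- Outcomes of the canonical game `G(X₀)`: the sequences `X₀, C₁, X₁, …, Cₙ, Xₙ`. -/
def COutcome {A Prp : Type} (X₀ : Set (Formula A Prp)) :=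
  {l : List (Set A × Set (Formula A Prp)) // ValidChain X₀ l}

/-- `hd ω`: the last maximal consistent set of the sequence ω. -/
def hd {A Prp : Type} (X₀ : Set (Formula A Prp)) (ω : COutcome X₀) :
    Set (Formula A Prp) :=
  (ω.1.map Prod.snd).getLastD X₀

/-- `ω ∼_a ω'`: every edge along the unique path between the tree nodes ω and ω'
is labeled with agent a (equivalently, after removing a common prefix, every
coalition label remaining in either sequence contains a). -/
def simOut {A Prp : Type} (X₀ : Set (Formula A Prp)) (a : A) (ω ω' : COutcome X₀) : Prop :=
  ∃ ρ t₁ t₂, ω.1 = ρ ++ t₁ ∧ ω'.1 = ρ ++ t₂ ∧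
    (∀ st ∈ t₁, a ∈ st.1) ∧ (∀ st ∈ t₂, a ∈ st.1)

/-- `ω ∼_C ω'`. -/
def simOutC {A Prp : Type} (X₀ : Set (Formula A Prp)) (C : Set A)
    (ω ω' : COutcome X₀) : Prop :=
  ∀ a ∈ C, simOut X₀ a ω ω'

/-- Initial states of the canonical game: equivalence classes Ω/∼_𝒜. -/
def CanonI {A Prp : Type} (X₀ : Set (Formula A Prp)) :=
  Quot (fun ω ω' : COutcome X₀ => ∀ a : A, simOut X₀ a ω ω')

/-- `α ∼_C α'` on initial states. -/
def simIC {A Prp : Type} (X₀ : Set (Formula A Prp)) (C : Set A)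
    (α α' : CanonI X₀) : Prop :=
  ∃ ω ω' : COutcome X₀, Quot.mk _ ω = α ∧ Quot.mk _ ω' = α' ∧ simOutC X₀ C ω ω'

/-- Plays of the canonical game `G(X₀)`: triples `(α, δ, ω)` such that `ω ∈ α` and
for every formula `K̄_C B_C ψ ∈ hd(ω)`, if `δ(a) = ψ` for each `a ∈ C`, then
`¬ψ ∈ hd(ω)`. The set of actions is Δ = Φ. -/
def CanonP {A Prp : Type} (X₀ : Set (Formula A Prp)) :
    Set (CanonI X₀ × (A → Formula A Prp) × COutcome X₀) :=
  {t | Quot.mk _ t.2.2 = t.1 ∧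
    ∀ (C : Set A) (ψ : Formula A Prp),
      Formula.kbar C (Formula.blame C ψ) ∈ hd X₀ t.2.2 →
      (∀ a ∈ C, t.2.1 a = ψ) → Formula.neg ψ ∈ hd X₀ t.2.2}

section CanonicalPlay
variable {A Prp : Type}

theorem pf_mono {X Y : Set (Formula A Prp)} (h : X ⊆ Y) {φ : Formula A Prp}
    (d : ProvableFrom X φ) : ProvableFrom Y φ := by
  induction d with
  | thm d => exact .thm d
  | hyp hm => exact .hyp (h hm)
  | mp _ _ ih1 ih2 => exact .mp ih1 ih2

theorem pf_deduction {X : Set (Formula A Prp)} {φ ψ : Formula A Prp}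
    (d : ProvableFrom (insert φ X) ψ) : ProvableFrom X (.imp φ ψ) := by
  induction d with
  | @thm χ d =>
    exact .mp (.thm (.taut (φ := .imp χ (.imp φ χ)) (by intro v; simp only [evalF]; tauto))) (.thm d)
  | @hyp χ hm =>
    rcases hm with rfl | hm
    · exact .thm (.taut (by intro v; simp only [evalF]; tauto))
    · exact .mp (.thm (.taut (φ := .imp χ (.imp φ χ)) (by intro v; simp only [evalF]; tauto)))
        (.hyp hm)
  | @mp a b _ _ ih1 ih2 =>
    exact .mp (.mp (.thm (.taut (φ := .imp (.imp φ (.imp a b)) (.imp (.imp φ a) (.imp φ b)))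
      (by intro v; simp only [evalF]; tauto))) ih1) ih2

theorem mc_closed {X : Set (Formula A Prp)} (h : MaxCons X) {φ : Formula A Prp}
    (d : ProvableFrom X φ) : φ ∈ X := by
  have hc : Consistent (insert φ X) := by
    intro hb
    exact h.1 (.mp (pf_deduction hb) d)
  have := h.2 _ hc (Set.subset_insert _ _)
  rw [← this]
  exact Set.mem_insert _ _

theorem mc_thm {X : Set (Formula A Prp)} (h : MaxCons X) {φ : Formula A Prp}
    (d : Provable φ) : φ ∈ X := mc_closed h (.thm d)

theorem mc_mp {X : Set (Formula A Prp)} (h : MaxCons X) {φ ψ : Formula A Prp}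
    (d : Formula.imp φ ψ ∈ X) (e : φ ∈ X) : ψ ∈ X := mc_closed h (.mp (.hyp d) (.hyp e))

theorem mc_ax {X : Set (Formula A Prp)} (h : MaxCons X) {φ ψ : Formula A Prp}
    (d : Provable (Formula.imp φ ψ)) (e : φ ∈ X) : ψ ∈ X := mc_mp h (mc_thm h d) e

theorem mc_bot {X : Set (Formula A Prp)} (h : MaxCons X) : Formula.bot ∉ X :=
  fun hb => h.1 (.hyp hb)

theorem mc_neg {X : Set (Formula A Prp)} (h : MaxCons X) (φ : Formula A Prp) :
    Formula.neg φ ∈ X ↔ φ ∉ X := by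
  constructor
  · intro hn hp
    apply mc_bot h
    exact mc_mp h (mc_ax h (.taut (φ := .imp (.neg φ) (.imp φ .bot))
      (by intro v; simp only [evalF]; tauto)) hn) hp
  · intro hp
    by_cases hc : Consistent (insert φ X)
    · exact absurd (by rw [← h.2 _ hc (Set.subset_insert _ _)]; exact Set.mem_insert _ _) hp
    · have d := pf_deduction (not_not.mp hc)
      exact mc_ax h (.taut (φ := .imp (.imp φ .bot) (.neg φ))
        (by intro v; simp only [evalF]; tauto)) (mc_closed h d)

theorem mc_imp {X : Set (Formula A Prp)} (h : MaxCons X) (φ ψ : Formula A Prp) :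
    Formula.imp φ ψ ∈ X ↔ (φ ∈ X → ψ ∈ X) := by
  constructor
  · exact fun d e => mc_mp h d e
  · intro hi
    by_cases hp : φ ∈ X
    · exact mc_ax h (.taut (φ := .imp ψ (.imp φ ψ))
        (by intro v; simp only [evalF]; tauto)) (hi hp)
    · exact mc_ax h (.taut (φ := .imp (.neg φ) (.imp φ ψ))
        (by intro v; simp only [evalF]; tauto)) ((mc_neg h _).2 hp)

theorem mc_eval {X : Set (Formula A Prp)} (h : MaxCons X) (φ : Formula A Prp) :
    evalF (· ∈ X) φ ↔ φ ∈ X := by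
  induction φ with
  | var p => rfl
  | bot => simp [evalF, mc_bot h]
  | neg φ ih => simp [evalF, mc_neg h, ih]
  | imp φ ψ ih1 ih2 => simp [evalF, mc_imp h, ih1, ih2]
  | know C φ => rfl
  | blame C φ => rfl

theorem mc_know_mp {X : Set (Formula A Prp)} (h : MaxCons X) {C : Set A} {φ ψ : Formula A Prp}
    (d : Provable (Formula.imp φ ψ)) (e : Formula.know C φ ∈ X) : Formula.know C ψ ∈ X :=
  mc_mp h (mc_ax h .distr (mc_thm h (.nec d))) e

theorem prov_tr {φ ψ χ : Formula A Prp} (d : Provable (Formula.imp φ ψ))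
    (e : Provable (Formula.imp ψ χ)) : Provable (Formula.imp φ χ) :=
  .mp (.mp (.taut (φ := .imp (.imp φ ψ) (.imp (.imp ψ χ) (.imp φ χ)))
    (by intro v; simp only [evalF]; tauto)) d) e

theorem prov_contra {φ ψ : Formula A Prp} (d : Provable (Formula.imp φ ψ)) :
    Provable (Formula.imp (.neg ψ) (.neg φ)) :=
  .mp (.taut (φ := .imp (.imp φ ψ) (.imp (.neg ψ) (.neg φ)))
    (by intro v; simp only [evalF]; tauto)) d

/-- Membership form of `φ → K̄ φ`. -/
theorem mc_kbar_intro {X : Set (Formula A Prp)} (h : MaxCons X) {C : Set A} {φ : Formula A Prp}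
    (e : φ ∈ X) : Formula.kbar C φ ∈ X := by
  refine (mc_neg h _).2 fun hk => ?_
  exact (mc_neg h _).1 (mc_ax h .truthK hk) e

/-- Positive introspection. -/
theorem mc_pos {X : Set (Formula A Prp)} (h : MaxCons X) {C : Set A} {φ : Formula A Prp}
    (e : Formula.know C φ ∈ X) : Formula.know C (.know C φ) ∈ X := by
  have h1 : Formula.neg (.know C (.neg (.know C φ))) ∈ X := mc_kbar_intro h e
  have h2 := mc_ax h .negIntro h1
  refine mc_know_mp h ?_ h2
  have := prov_contra (Provable.negIntro (C := C) (φ := φ))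
  exact prov_tr this (.taut (by intro v; simp only [evalF]; tauto))

/-- `K̄_C B_C φ → (φ → B_C φ)`. -/
theorem mc_base {X : Set (Formula A Prp)} (h : MaxCons X) {C : Set A} {φ : Formula A Prp}
    (e : Formula.kbar C (.blame C φ) ∈ X) (hp : φ ∈ X) : Formula.blame C φ ∈ X := by
  have hk : Formula.know C (.imp φ (.blame C φ)) ∈ X := by
    by_contra hk
    have h2 := mc_ax h .negIntro ((mc_neg h _).2 hk)
    exact (mc_neg h _).1 e (mc_know_mp h (prov_contra .fairness) h2)
  exact mc_mp h (mc_ax h .truthK hk) hp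

theorem pf_sUnion {c : Set (Set (Formula A Prp))} (hc : IsChain (· ⊆ ·) c) (hne : c.Nonempty)
    {φ : Formula A Prp} (d : ProvableFrom (⋃₀ c) φ) : ∃ Y ∈ c, ProvableFrom Y φ := by
  induction d with
  | thm d => exact ⟨_, hne.some_mem, .thm d⟩
  | hyp hm =>
    obtain ⟨Y, hY, hm⟩ := hm
    exact ⟨Y, hY, .hyp hm⟩
  | mp _ _ ih1 ih2 =>
    obtain ⟨Y, hY, d1⟩ := ih1
    obtain ⟨Z, hZ, d2⟩ := ih2
    rcases hc.total hY hZ with hs | hs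
    · exact ⟨Z, hZ, .mp (pf_mono hs d1) d2⟩
    · exact ⟨Y, hY, .mp d1 (pf_mono hs d2)⟩

theorem lindenbaum {X : Set (Formula A Prp)} (h : Consistent X) : ∃ Y, X ⊆ Y ∧ MaxCons Y := by
  obtain ⟨Y, hXY, hY⟩ := zorn_subset_nonempty {Y : Set (Formula A Prp) | Consistent Y}
    (fun c hc hch hne => ⟨⋃₀ c, fun hb => by
      obtain ⟨Z, hZ, d⟩ := pf_sUnion hch hne hb
      exact hc hZ d, fun s hs => Set.subset_sUnion_of_mem hs⟩) X h
  exact ⟨Y, hXY, hY.prop, fun Z hZ hs => (hY.eq_of_subset hZ hs).symm⟩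

def disjL : List (Formula A Prp) → Formula A Prp
  | [] => .bot
  | φ :: l => .or φ (disjL l)

theorem eval_or (v : Formula A Prp → Prop) (φ ψ : Formula A Prp) :
    evalF v (.or φ ψ) ↔ evalF v φ ∨ evalF v ψ := by
  simp only [Formula.or, evalF]; tauto

theorem eval_disjL (v : Formula A Prp → Prop) (l : List (Formula A Prp)) :
    evalF v (disjL l) ↔ ∃ ψ ∈ l, evalF v ψ := by
  induction l with
  | nil => simp [disjL, evalF]
  | cons φ l ih => simp [disjL, eval_or, ih]

theorem pf_compact {X T : Set (Formula A Prp)} (h : MaxCons X) (C : Set A) {φ : Formula A Prp}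
    (d : ProvableFrom ({χ | Formula.know C χ ∈ X} ∪ {χ | ∃ ψ ∈ T, χ = .neg ψ}) φ) :
    ∃ l : List (Formula A Prp), (∀ ψ ∈ l, ψ ∈ T) ∧ Formula.know C (.or (disjL l) φ) ∈ X := by
  induction d with
  | @thm χ d =>
    refine ⟨[], by simp, mc_thm h (.nec (.mp (.taut (φ := .imp χ _) ?_) d))⟩
    intro v hv
    rw [eval_or]; exact .inr hv
  | @hyp χ hm =>
    rcases hm with hm | ⟨ψ, hψ, rfl⟩
    · refine ⟨[], by simp, mc_know_mp h (.taut ?_) hm⟩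
      intro v hv
      rw [eval_or]; exact .inr hv
    · refine ⟨[ψ], by simpa using hψ, mc_thm h (.nec (.taut ?_))⟩
      intro v
      rw [eval_or, eval_disjL]
      simp only [evalF, List.mem_singleton, exists_eq_left]
      tauto
  | @mp a b _ _ ih1 ih2 =>
    obtain ⟨l1, h1, k1⟩ := ih1
    obtain ⟨l2, h2, k2⟩ := ih2
    refine ⟨l1 ++ l2, ?_, ?_⟩
    · intro ψ hψ
      rcases List.mem_append.1 hψ with hψ | hψ
      · exact h1 _ hψ
      · exact h2 _ hψ
    · refine mc_mp h (mc_ax h .distr (mc_know_mp h (.taut ?_) k1)) k2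
      intro v
      simp only [evalF, eval_or, eval_disjL, List.mem_append]
      rintro (⟨ψ, hψ, e⟩ | hi) (⟨χ, hχ, e'⟩ | ha)
      · exact .inl ⟨ψ, .inl hψ, e⟩
      · exact .inl ⟨ψ, .inl hψ, e⟩
      · exact .inl ⟨χ, .inr hχ, e'⟩
      · exact .inr (hi ha)

theorem joint_list {X : Set (Formula A Prp)} (h : MaxCons X) (δ : A → Formula A Prp)
    {ψ₀ : Formula A Prp} (h0 : ψ₀ ∈ X)
    (hT0 : ∃ C, Formula.kbar C (.blame C ψ₀) ∈ X ∧ ∀ a ∈ C, δ a = ψ₀)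
    (l : List (Formula A Prp))
    (hl : ∀ ψ ∈ l, ∃ C, Formula.kbar C (.blame C ψ) ∈ X ∧ ∀ a ∈ C, δ a = ψ) :
    ∃ (C : Set A) (χ : Formula A Prp), Formula.blame C χ ∈ X ∧ (∀ a ∈ C, δ a ∈ ψ₀ :: l) ∧
      ∀ v, ∀ ψ ∈ ψ₀ :: l, evalF v ψ → evalF v χ := by
  induction l with
  | nil =>
    obtain ⟨C, hC, hd⟩ := hT0
    exact ⟨C, ψ₀, mc_base h hC h0, fun a ha => by simp [hd a ha], by simp⟩
  | cons ψ l ih =>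
    obtain ⟨C, χ, hB, hC, hv⟩ := ih fun ψ hψ => hl ψ (List.mem_cons_of_mem _ hψ)
    obtain ⟨D, hD, hd⟩ := hl ψ List.mem_cons_self
    by_cases hdis : Disjoint C D
    · refine ⟨C ∪ D, .or χ ψ, ?_, ?_, ?_⟩
      · have hχ : χ ∈ X := mc_ax h .truthB hB
        have hk : Formula.kbar C (.blame C χ) ∈ X := mc_kbar_intro h hB
        have hor : Formula.or χ ψ ∈ X := by
          rw [← mc_eval h, eval_or, mc_eval h]; exact .inl hχ
        refine mc_mp h (mc_ax h (.jointResp hdis) ?_) hor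
        rw [← mc_eval h] at hk hD ⊢
        simp only [Formula.and, evalF] at hk hD ⊢
        tauto
      · rintro a (ha | ha)
        · have := hC a ha
          simp only [List.mem_cons] at this ⊢
          tauto
        · simp [hd a ha]
      · intro v ψ' hψ' he
        rw [eval_or]
        simp only [List.mem_cons] at hψ' hv
        rcases hψ' with rfl | rfl | hm
        · exact .inl (hv v _ (.inl rfl) he)
        · exact .inr he
        · exact .inl (hv v _ (.inr hm) he)
    · obtain ⟨a, ha, ha'⟩ := Set.not_disjoint_iff.1 hdis
      have hm : ψ ∈ ψ₀ :: l := by rw [← hd a ha']; exact hC a ha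
      refine ⟨C, χ, hB, ?_, ?_⟩
      · intro b hb
        have := hC b hb
        simp only [List.mem_cons] at this ⊢
        tauto
      · intro v ψ' hψ' he
        simp only [List.mem_cons] at hψ'
        rcases hψ' with rfl | rfl | hm'
        · exact hv v _ List.mem_cons_self he
        · exact hv v _ hm he
        · exact hv v _ (List.mem_cons_of_mem _ hm') he

theorem exists_next {X : Set (Formula A Prp)} (h : MaxCons X) (δ : A → Formula A Prp) :
    ∃ Y, MaxCons Y ∧ (∀ φ, Formula.know Set.univ φ ∈ X → φ ∈ Y) ∧
      ∀ (C : Set A) (ψ : Formula A Prp), Formula.kbar C (.blame C ψ) ∈ Y →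
        (∀ a ∈ C, δ a = ψ) → Formula.neg ψ ∈ Y := by
  set T : Set (Formula A Prp) :=
    {ψ | ∃ C, Formula.kbar C (.blame C ψ) ∈ X ∧ ∀ a ∈ C, δ a = ψ} with hT
  have hcons : Consistent
      ({χ | Formula.know Set.univ χ ∈ X} ∪ {χ | ∃ ψ ∈ T, χ = Formula.neg ψ}) := by
    intro hb
    obtain ⟨l, hl, hk⟩ := pf_compact h Set.univ hb
    have hm := mc_ax h .truthK hk
    rw [← mc_eval h, eval_or, eval_disjL] at hm
    rcases hm with ⟨ψ₀, hψ₀, he⟩ | hf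
    · rw [mc_eval h] at he
      obtain ⟨C, χ, hB, -, hv⟩ := joint_list h δ he (hl _ hψ₀) l hl
      have hB' := mc_ax h (.monoB (Set.subset_univ C)) hB
      have hk' : Formula.know Set.univ (.imp .top χ) ∈ X := by
        refine mc_know_mp h (.taut ?_) hk
        intro v
        simp only [evalF, eval_or, eval_disjL]
        rintro (⟨ψ, hψ, e⟩ | hf) _
        · exact hv v _ (List.mem_cons_of_mem _ hψ) e
        · exact hf.elim
      have ht : (Formula.top : Formula A Prp) ∈ X :=
        mc_thm h (.taut (by intro v; simp [Formula.top, evalF]))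
      have := mc_mp h (mc_mp h (mc_ax h .knownCause hk') hB') ht
      exact (mc_neg h _).1 (mc_thm h .blameTop) this
    · exact hf
  obtain ⟨Y, hs, hY⟩ := lindenbaum hcons
  refine ⟨Y, hY, fun φ hφ => hs (.inl hφ), ?_⟩
  intro C ψ hk hd
  refine hs (.inr ⟨ψ, ⟨C, ?_, hd⟩, rfl⟩)
  refine (mc_neg h _).2 fun hX => ?_
  have := hs (.inl (mc_ax h (.monoK (Set.subset_univ C)) (mc_pos h hX)))
  exact (mc_neg hY _).1 hk this

theorem chain_last {X : Set (Formula A Prp)} (hX : MaxCons X)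
    (l : List (Set A × Set (Formula A Prp))) (hl : ValidChain X l) :
    MaxCons ((l.map Prod.snd).getLastD X) ∧
      ∀ C Y, MaxCons Y → (∀ φ, Formula.know C φ ∈ (l.map Prod.snd).getLastD X → φ ∈ Y) →
        ValidChain X (l ++ [(C, Y)]) := by
  induction l generalizing X with
  | nil => exact ⟨hX, fun C Y hY hk => ⟨hY, hk, trivial⟩⟩
  | cons p l ih =>
    obtain ⟨D, Z⟩ := p
    obtain ⟨hZ, hk, hr⟩ := hl
    have := ih hZ hr
    rw [List.map_cons, List.getLastD_cons]
    exact ⟨this.1, fun C Y hY hk' => ⟨hZ, hk, this.2 C Y hY hk'⟩⟩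
end CanonicalPlay

/-- The canonical game satisfies the play-existence condition: for each initial
state α and each complete action profile δ there is an outcome ω with
(α, δ, ω) ∈ P. -/
theorem canonical_play_exists {A Prp : Type} (X₀ : Set (Formula A Prp))
    (hX₀ : MaxCons X₀) (α : CanonI X₀) (δ : A → Formula A Prp) :
    ∃ ω : COutcome X₀, (α, δ, ω) ∈ CanonP X₀ := by
  induction α using Quot.ind with
  | mk ω =>
    obtain ⟨h1, h2⟩ := chain_last hX₀ ω.1 ω.2
    obtain ⟨Y, hY, hk, hp⟩ := exists_next h1 δ
    refine ⟨⟨ω.1 ++ [(Set.univ, Y)], h2 _ _ hY hk⟩, ?_, ?_⟩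
    · refine (Quot.sound ?_).symm
      intro a
      exact ⟨ω.1, [], [(Set.univ, Y)], by simp, rfl, by simp, by simp⟩
    · have : hd X₀ ⟨ω.1 ++ [(Set.univ, Y)], h2 _ _ hY hk⟩ = Y := by
        simp [hd]
      simp only [this]
      exact hp
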